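/- Let e ≥ 10 be an integer and n = e−3. The defining toric ideal I_{S(e,1,e−3)} of the numerical semigroup S(e,1,e−3) inside R(e,1,e−3) = K[x_i : i ∈ {0, 2, 3, …, e−1} \ {e−3}] is generated, minimally, by the set G = J ∪ K ∪ L, where J = {x_i x_{j+1} − x_{i+1} x_j : i < j, i, j ∈ {2,…,e−2} \ {e−4, e−3}} ∪ {x_0^2 x_i − x_{i+1} x_{e−1} : i ∈ {2,…,e−2} \ {e−4, e−3}}, K = {x_0 x_{i+2} − x_2 x_i : i ∈ {2,…,e−3} \ {e−5, e−3}} ∪ {x_0^3 − x_2 x_{e−2}}, and L = {x_{e−4} x_{e−4−i} − x_{e−2} x_{e−6−i} : 0 ≤ i ≤ e−8} ∪ {x_{e−4} x_3 − x_0 x_{e−1}} ∪ {x_0^2 x_{e−4} − x_{e−2}^2, x_0 x_2 x_{e−5} − x_{e−2} x_{e−1}}. -/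

import Mathlib

open MvPolynomial

/-- Index set of the polynomial ring `R(e,m,n)`: indices `i ∈ {0,…,e−1} \ {m,n}`. -/
abbrev SallyIdx (e m n : ℕ) : Type := {i : ℕ // i < e ∧ i ≠ m ∧ i ≠ n}

/-- The variable `x_i` of `R(e,m,n)` (and `0` for an invalid index). -/
noncomputable def sX (e m n : ℕ) (i : ℕ) : MvPolynomial (SallyIdx e m n) ℚ :=
  if h : i < e ∧ i ≠ m ∧ i ≠ n then MvPolynomial.X ⟨i, h⟩ else 0

/-- The defining toric ideal `I_{S(e,m,n)}`: the kernel of the `ℚ`-algebra homomorphism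
`R(e,m,n) → ℚ[t]` sending `x_i ↦ t^{e+i}`. -/
noncomputable def sallyIdeal (e m n : ℕ) : Ideal (MvPolynomial (SallyIdx e m n) ℚ) :=
  RingHom.ker (MvPolynomial.aeval
    (fun i : SallyIdx e m n => (Polynomial.X : Polynomial ℚ) ^ (e + i.1))).toRingHom

/-- The generating set `G = J ∪ K ∪ L` for `I_{S(e,1,e−3)}`. -/
noncomputable def genSet (e : ℕ) : Set (MvPolynomial (SallyIdx e 1 (e-3)) ℚ) :=
  -- J
  {p | ∃ i j : ℕ, (2 ≤ i ∧ i ≤ e - 2 ∧ i ≠ e - 4 ∧ i ≠ e - 3) ∧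
      (2 ≤ j ∧ j ≤ e - 2 ∧ j ≠ e - 4 ∧ j ≠ e - 3) ∧ i < j ∧
      p = sX e 1 (e-3) i * sX e 1 (e-3) (j+1) - sX e 1 (e-3) (i+1) * sX e 1 (e-3) j} ∪
  {p | ∃ i : ℕ, (2 ≤ i ∧ i ≤ e - 2 ∧ i ≠ e - 4 ∧ i ≠ e - 3) ∧
      p = sX e 1 (e-3) 0 ^ 2 * sX e 1 (e-3) i - sX e 1 (e-3) (i+1) * sX e 1 (e-3) (e-1)} ∪
  -- K
  {p | ∃ i : ℕ, (2 ≤ i ∧ i ≤ e - 3 ∧ i ≠ e - 5 ∧ i ≠ e - 3) ∧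
      p = sX e 1 (e-3) 0 * sX e 1 (e-3) (i+2) - sX e 1 (e-3) 2 * sX e 1 (e-3) i} ∪
  {sX e 1 (e-3) 0 ^ 3 - sX e 1 (e-3) 2 * sX e 1 (e-3) (e-2)} ∪
  -- L
  {p | ∃ i : ℕ, i ≤ e - 8 ∧
      p = sX e 1 (e-3) (e-4) * sX e 1 (e-3) (e-4-i) -
          sX e 1 (e-3) (e-2) * sX e 1 (e-3) (e-6-i)} ∪
  {sX e 1 (e-3) (e-4) * sX e 1 (e-3) 3 - sX e 1 (e-3) 0 * sX e 1 (e-3) (e-1)} ∪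
  {sX e 1 (e-3) 0 ^ 2 * sX e 1 (e-3) (e-4) - sX e 1 (e-3) (e-2) ^ 2,
   sX e 1 (e-3) 0 * sX e 1 (e-3) 2 * sX e 1 (e-3) (e-5) -
     sX e 1 (e-3) (e-2) * sX e 1 (e-3) (e-1)}

/-! ### Normal forms modulo the binomial relations

Throughout, `e = f + 10`, so that `e - 5, e - 4, e - 3, e - 2, e - 1` are
`f + 5, f + 6, f + 7, f + 8, f + 9`. -/

/-- The relations imposed by `G = J ∪ K ∪ L` on elements `y i` of a commutative ring,
for `e = f + 10`. -/
structure SallyRelations {A : Type*} [CommRing A] (f : ℕ) (y : ℕ → A) : Prop where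
  minor : ∀ i j, 2 ≤ i → i < j → j ≤ f + 5 → y i * y (j + 1) = y (i + 1) * y j
  minor_last : ∀ i, 2 ≤ i → i ≤ f + 5 → y i * y (f + 9) = y (i + 1) * y (f + 8)
  sq_mul : ∀ i, 2 ≤ i → i ≤ f + 5 → y 0 ^ 2 * y i = y (i + 1) * y (f + 9)
  sq_mul_last : y 0 ^ 2 * y (f + 8) = y (f + 9) * y (f + 9)
  two_mul : ∀ i, 2 ≤ i → i ≤ f + 4 → y 0 * y (i + 2) = y 2 * y i
  two_mul_last : y 0 * y (f + 8) = y 2 * y (f + 6)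
  cube : y 0 ^ 3 = y 2 * y (f + 8)
  skip : ∀ j, 2 ≤ j → j ≤ f + 4 → y (f + 6) * y (j + 2) = y (f + 8) * y j
  three_mul : y (f + 6) * y 3 = y 0 * y (f + 9)
  sq_last : y 0 ^ 2 * y (f + 6) = y (f + 8) ^ 2
  mul_last : y 0 * y 2 * y (f + 5) = y (f + 8) * y (f + 9)

/-- The monomial representing the Apéry element of residue `r`. -/
def aperyMonomial {A : Type*} [CommRing A] (f : ℕ) (y : ℕ → A) (r : ℕ) : A :=
  if r = 0 then 1 else if r = 1 then y 2 * y (f + 9)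
  else if r = f + 7 then y 2 * y (f + 5) else y r

/-- The quotient by `e` of the Apéry element of residue `r`. -/
def aperyQuotient (f r : ℕ) : ℕ :=
  if r = 0 then 0 else if r = 1 then 3 else if r = f + 7 then 2 else 1

/-- `a` is the normal form `y₀ᵏ w`, with `w` an Apéry monomial, of degree `s`. -/
def IsNormalForm {A : Type*} [CommRing A] (f : ℕ) (y : ℕ → A) (s : ℕ) (a : A) : Prop :=
  ∃ k r, r < f + 10 ∧ a = y 0 ^ k * aperyMonomial f y r ∧
    s = r + (f + 10) * (k + aperyQuotient f r)

section NormalForm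

variable {A : Type*} [CommRing A] {f : ℕ} {y : ℕ → A}

theorem IsNormalForm.unique {s : ℕ} {a b : A} (ha : IsNormalForm f y s a)
    (hb : IsNormalForm f y s b) : a = b := by
  obtain ⟨k, r, hr, rfl, hs⟩ := ha
  obtain ⟨k', r', hr', rfl, hs'⟩ := hb
  have h1 : s % (f + 10) = r := by rw [hs, Nat.add_mul_mod_self_left, Nat.mod_eq_of_lt hr]
  have h2 : s % (f + 10) = r' := by rw [hs', Nat.add_mul_mod_self_left, Nat.mod_eq_of_lt hr']
  obtain rfl : r = r' := h1.symm.trans h2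
  have h3 : (f + 10) * (k + aperyQuotient f r) = (f + 10) * (k' + aperyQuotient f r) := by omega
  have h4 := Nat.eq_of_mul_eq_mul_left (by omega) h3
  obtain rfl : k = k' := by omega
  rfl

theorem IsNormalForm.pow_mul {s : ℕ} {a : A} (ha : IsNormalForm f y s a) (k : ℕ) :
    IsNormalForm f y (s + (f + 10) * k) (y 0 ^ k * a) := by
  obtain ⟨l, r, hr, rfl, hs⟩ := ha
  exact ⟨k + l, r, hr, by ring, by rw [hs]; ring⟩

theorem IsNormalForm.congr {s t : ℕ} {a b : A} (ha : IsNormalForm f y s a) (hs : t = s)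
    (hab : b = a) : IsNormalForm f y t b := by
  subst hs hab; exact ha

theorem isNormalForm_one : IsNormalForm f y 0 1 :=
  ⟨0, 0, by omega, by simp [aperyMonomial], by simp [aperyQuotient]⟩

theorem isNormalForm_var {i : ℕ} (hi : i < f + 10 ∧ i ≠ 1 ∧ i ≠ f + 7) :
    IsNormalForm f y (f + 10 + i) (y i) := by
  obtain ⟨h, h1, h7⟩ := hi
  rcases Nat.eq_zero_or_pos i with rfl | h0
  · exact (isNormalForm_one.pow_mul 1).congr (by omega) (by ring)
  · exact ⟨0, i, h, by simp [aperyMonomial, h1, h7, h0.ne'],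
      by simp [aperyQuotient, h1, h7, h0.ne']; omega⟩

theorem isNormalForm_apery_one : IsNormalForm f y (3 * (f + 10) + 1) (y 2 * y (f + 9)) :=
  ⟨0, 1, by omega, by simp [aperyMonomial], by simp [aperyQuotient]; omega⟩

theorem isNormalForm_apery_gap :
    IsNormalForm f y (2 * (f + 10) + (f + 7)) (y 2 * y (f + 5)) :=
  ⟨0, f + 7, by omega, by simp [aperyMonomial], by simp [aperyQuotient]; omega⟩

theorem SallyRelations.shift_one (H : SallyRelations f y) {i j : ℕ} (hi : 2 ≤ i)
    (hi' : i ≤ f + 5) (hj : 2 ≤ j) (hj' : j ≤ f + 5) : y (i + 1) * y j = y i * y (j + 1) := by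
  rcases lt_trichotomy i j with h | rfl | h
  · exact (H.minor i j hi h hj').symm
  · ring
  · rw [mul_comm, H.minor j i hj h hi', mul_comm]

theorem SallyRelations.shift (H : SallyRelations f y) {i j : ℕ} (t : ℕ) (hi : 2 ≤ i)
    (hi' : i + t ≤ f + 6) (hj : 2 ≤ j) (hj' : j + t ≤ f + 6) :
    y (i + t) * y j = y i * y (j + t) := by
  induction t generalizing j with
  | zero => rfl
  | succ t ih =>
    rw [← add_assoc, H.shift_one (by omega) (by omega) hj (by omega),
      ih (by omega) (by omega) (by omega)]
    congr 2; omega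

theorem SallyRelations.mul_eq_mul (H : SallyRelations f y) {i j k l : ℕ} (hi : 2 ≤ i)
    (hi' : i ≤ f + 6) (hj : 2 ≤ j) (hj' : j ≤ f + 6) (hk : 2 ≤ k) (hk' : k ≤ f + 6)
    (hl : 2 ≤ l) (hl' : l ≤ f + 6) (h : i + j = k + l) : y i * y j = y k * y l := by
  rcases le_total i k with hik | hik
  · obtain ⟨t, rfl⟩ := Nat.exists_eq_add_of_le hik
    obtain rfl : j = l + t := by omega
    exact (H.shift t hi hk' hl hj').symm
  · obtain ⟨t, rfl⟩ := Nat.exists_eq_add_of_le hik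
    obtain rfl : l = j + t := by omega
    exact H.shift t hk hi' hj hl'

theorem SallyRelations.isNormalForm_mul_last (H : SallyRelations f y) {q : ℕ} (hq : 2 ≤ q)
    (hq' : q ≤ f + 6) : IsNormalForm f y (2 * (f + 10) + q + (f + 9)) (y q * y (f + 9)) := by
  rcases hq.eq_or_lt with rfl | h
  · exact isNormalForm_apery_one.congr (by omega) rfl
  · obtain ⟨i, rfl⟩ : ∃ i, q = i + 1 := ⟨q - 1, by omega⟩
    exact ((isNormalForm_var (i := i) (by omega)).pow_mul 2).congr (by omega)
      (H.sq_mul i (by omega) (by omega)).symm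

theorem SallyRelations.isNormalForm_mul_penultimate (H : SallyRelations f y) {q : ℕ}
    (hq : 2 ≤ q) (hq' : q ≤ f + 6) :
    IsNormalForm f y (2 * (f + 10) + q + (f + 8)) (y q * y (f + 8)) := by
  rcases hq.eq_or_lt with rfl | h
  · exact (isNormalForm_one.pow_mul 3).congr (by omega) (by rw [← H.cube, mul_one])
  · obtain ⟨i, rfl⟩ : ∃ i, q = i + 1 := ⟨q - 1, by omega⟩
    exact (H.isNormalForm_mul_last (q := i) (by omega) (by omega)).congr (by omega)
      (H.minor_last i (by omega) (by omega)).symm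

theorem SallyRelations.isNormalForm_mul_small (H : SallyRelations f y) {i j : ℕ} (hi : 2 ≤ i)
    (hi' : i ≤ f + 6) (hj : 2 ≤ j) (hj' : j ≤ f + 6) :
    IsNormalForm f y (2 * (f + 10) + i + j) (y i * y j) := by
  rcases le_or_gt (i + j) (f + 8) with h | h
  · obtain ⟨l, hl⟩ : ∃ l, i + j = 2 + l := ⟨i + j - 2, by omega⟩
    rw [H.mul_eq_mul hi hi' hj hj' le_rfl (by omega) (by omega) (by omega) hl]
    have hl6 : l ≤ f + 4 ∨ l = f + 5 ∨ l = f + 6 := by omega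
    rcases hl6 with h4 | rfl | rfl
    · exact ((isNormalForm_var (i := l + 2) (by omega)).pow_mul 1).congr (by omega)
        (by rw [pow_one, H.two_mul l (by omega) h4])
    · exact isNormalForm_apery_gap.congr (by omega) rfl
    · exact ((isNormalForm_var (i := f + 8) (by omega)).pow_mul 1).congr (by omega)
        (by rw [pow_one, H.two_mul_last])
  · obtain ⟨l, hl⟩ : ∃ l, i + j = (f + 6) + (l + 2) := ⟨i + j - (f + 8), by omega⟩
    rw [H.mul_eq_mul hi hi' hj hj' (by omega) le_rfl (by omega) (by omega) hl]
    have hl1 : l = 1 ∨ 2 ≤ l := by omega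
    rcases hl1 with rfl | h2
    · exact ((isNormalForm_var (i := f + 9) (by omega)).pow_mul 1).congr (by omega)
        (by rw [pow_one, H.three_mul])
    · exact (H.isNormalForm_mul_penultimate (q := l) (by omega) (by omega)).congr (by omega)
        (by rw [H.skip l h2 (by omega), mul_comm])

theorem SallyRelations.isNormalForm_mul (H : SallyRelations f y) {i j : ℕ}
    (hi : i < f + 10 ∧ i ≠ 1 ∧ i ≠ f + 7) (hj : j < f + 10 ∧ j ≠ 1 ∧ j ≠ f + 7) :
    IsNormalForm f y (2 * (f + 10) + i + j) (y i * y j) := by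
  wlog hij : i ≤ j generalizing i j
  · exact (this hj hi (by omega)).congr (by omega) (mul_comm _ _)
  have hi0 : i = 0 ∨ 2 ≤ i := by omega
  rcases hi0 with rfl | hi2
  · exact ((isNormalForm_var hj).pow_mul 1).congr (by omega) (by rw [pow_one])
  have hj3 : j ≤ f + 6 ∨ j = f + 8 ∨ j = f + 9 := by omega
  have hi3 : i ≤ f + 6 ∨ i = f + 8 ∨ i = f + 9 := by omega
  rcases hj3 with hj6 | rfl | rfl
  · exact H.isNormalForm_mul_small hi2 (by omega) (by omega) hj6
  · rcases hi3 with hi6 | rfl | rfl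
    · exact H.isNormalForm_mul_penultimate hi2 hi6
    · exact ((isNormalForm_var (i := f + 6) (by omega)).pow_mul 2).congr (by omega)
        (by rw [H.sq_last, sq])
    · omega
  · rcases hi3 with hi6 | rfl | rfl
    · exact H.isNormalForm_mul_last hi2 hi6
    · exact (isNormalForm_apery_gap.pow_mul 1).congr (by omega)
        (by rw [pow_one, ← mul_assoc, H.mul_last])
    · exact ((isNormalForm_var (i := f + 8) (by omega)).pow_mul 2).congr (by omega)
        H.sq_mul_last.symm

theorem SallyRelations.isNormalForm_mul_apery_one (H : SallyRelations f y) {i : ℕ}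
    (hi : i < f + 10 ∧ i ≠ 1 ∧ i ≠ f + 7) :
    IsNormalForm f y (4 * (f + 10) + i + 1) (y i * (y 2 * y (f + 9))) := by
  have hc : i = 0 ∨ i = 2 ∨ (3 ≤ i ∧ i ≤ f + 6) ∨ i = f + 8 ∨ i = f + 9 := by omega
  rcases hc with rfl | rfl | ⟨h3, h6⟩ | rfl | rfl
  · exact (isNormalForm_apery_one.pow_mul 1).congr (by omega) (by rw [pow_one])
  · refine ((H.isNormalForm_mul_last (q := 4) (by omega) (by omega)).pow_mul 1).congr
      (by omega) ?_
    rw [pow_one, ← mul_assoc, ← H.two_mul 2 le_rfl (by omega), mul_assoc]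
  · obtain ⟨l, rfl⟩ : ∃ l, i = l + 1 := ⟨i - 1, by omega⟩
    refine ((H.isNormalForm_mul (i := 2) (j := l) (by omega) (by omega)).pow_mul 2).congr
      (by omega) ?_
    rw [mul_left_comm, ← H.sq_mul l (by omega) (by omega), mul_left_comm]
  · refine ((isNormalForm_var (i := f + 9) (by omega)).pow_mul 3).congr (by omega) ?_
    rw [H.cube]; ring
  · refine ((H.isNormalForm_mul (i := 2) (j := f + 8) (by omega) (by omega)).pow_mul 2).congr
      (by omega) ?_
    rw [mul_left_comm, ← H.sq_mul_last, mul_left_comm]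

theorem SallyRelations.isNormalForm_mul_apery_gap (H : SallyRelations f y) {i : ℕ}
    (hi : i < f + 10 ∧ i ≠ 1 ∧ i ≠ f + 7) :
    IsNormalForm f y (3 * (f + 10) + i + (f + 7)) (y i * (y 2 * y (f + 5))) := by
  have hc : i = 0 ∨ (2 ≤ i ∧ i ≤ f + 4) ∨ i = f + 5 ∨ i = f + 6 ∨ i = f + 8 ∨ i = f + 9 := by
    omega
  rcases hc with rfl | ⟨h2, h4⟩ | rfl | rfl | rfl | rfl
  · exact (isNormalForm_apery_gap.pow_mul 1).congr (by omega) (by rw [pow_one])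
  · refine ((H.isNormalForm_mul (i := i + 2) (j := f + 5) (by omega) (by omega)).pow_mul
      1).congr (by omega) ?_
    rw [← mul_assoc, mul_comm (y i), ← H.two_mul i h2 h4]; ring
  · have hsq : y (f + 5) * y (f + 5) = y (f + 6) * y (f + 4) :=
      H.mul_eq_mul (by omega) (by omega) (by omega) (by omega) (by omega) (by omega) (by omega)
        (by omega) (by omega)
    refine ((H.isNormalForm_mul (i := f + 8) (j := f + 4) (by omega) (by omega)).pow_mul
      1).congr (by omega) ?_
    rw [mul_left_comm, hsq, pow_one, ← mul_assoc, ← mul_assoc, H.two_mul_last]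
  · refine ((H.isNormalForm_mul (i := f + 8) (j := f + 5) (by omega) (by omega)).pow_mul
      1).congr (by omega) ?_
    rw [← mul_assoc, mul_comm (y (f + 6)), ← H.two_mul_last]; ring
  · refine ((isNormalForm_var (i := f + 5) (by omega)).pow_mul 3).congr (by omega) ?_
    rw [H.cube]; ring
  · refine ((H.isNormalForm_mul (i := 2) (j := f + 4) (by omega) (by omega)).pow_mul 2).congr
      (by omega) ?_
    rw [mul_left_comm (y 0 ^ 2), H.sq_mul (f + 4) (by omega) (by omega)]; ring

theorem SallyRelations.isNormalForm_var_mul (H : SallyRelations f y) {i s : ℕ} {a : A}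
    (hi : i < f + 10 ∧ i ≠ 1 ∧ i ≠ f + 7) (ha : IsNormalForm f y s a) :
    IsNormalForm f y (s + (f + 10 + i)) (y i * a) := by
  obtain ⟨k, r, hr, rfl, rfl⟩ := ha
  suffices h : IsNormalForm f y (r + (f + 10) * aperyQuotient f r + (f + 10 + i))
      (y i * aperyMonomial f y r) from (h.pow_mul k).congr (by ring) (by ring)
  have hc : r = 0 ∨ r = 1 ∨ r = f + 7 ∨ (2 ≤ r ∧ r ≠ f + 7) := by omega
  rcases hc with rfl | rfl | rfl | ⟨h2, h7⟩
  · exact (isNormalForm_var hi).congr (by simp [aperyQuotient]) (by simp [aperyMonomial])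
  · exact (H.isNormalForm_mul_apery_one hi).congr (by simp [aperyQuotient]; omega)
      (by simp [aperyMonomial])
  · exact (H.isNormalForm_mul_apery_gap hi).congr (by simp [aperyQuotient]; omega)
      (by simp [aperyMonomial])
  · have h0 : r ≠ 0 := by omega
    have h1 : r ≠ 1 := by omega
    exact (H.isNormalForm_mul hi ⟨hr, h1, h7⟩).congr
      (by simp [aperyQuotient, h0, h1, h7]; omega) (by simp [aperyMonomial, h0, h1, h7])

end NormalForm

/-! ### The span of `G` is the toric ideal -/

theorem sX_of_valid {e m n i : ℕ} (h : i < e ∧ i ≠ m ∧ i ≠ n) :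
    sX e m n i = X ⟨i, h⟩ := dif_pos h

theorem mem_sallyIdeal {e m n : ℕ} {p : MvPolynomial (SallyIdx e m n) ℚ} :
    p ∈ sallyIdeal e m n ↔
      aeval (fun i : SallyIdx e m n => (Polynomial.X : Polynomial ℚ) ^ (e + i.1)) p = 0 :=
  Iff.rfl

theorem genSet_subset_sallyIdeal (f : ℕ) :
    genSet (f + 10) ⊆ (sallyIdeal (f + 10) 1 (f + 10 - 3) : Set _) := by
  intro p hp
  rw [SetLike.mem_coe, mem_sallyIdeal]
  rcases hp with (((((⟨i, j, hi, hj, hij, rfl⟩ | ⟨i, hi, rfl⟩) | ⟨i, hi, rfl⟩) | rfl) |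
    ⟨i, hi, rfl⟩) | rfl) | rfl | rfl <;>
  · repeat rw [sX_of_valid (by omega)]
    simp only [map_sub, map_mul, map_pow, aeval_X, ← pow_add, ← pow_mul]
    rw [sub_eq_zero]
    congr 1
    omega

theorem sallyRelations_mk (f : ℕ) :
    SallyRelations f (fun i => Ideal.Quotient.mk (Ideal.span (genSet (f + 10)))
      (sX (f + 10) 1 (f + 10 - 3) i)) := by
  have key : ∀ a b, a - b ∈ genSet (f + 10) →
      Ideal.Quotient.mk (Ideal.span (genSet (f + 10))) a =
        Ideal.Quotient.mk (Ideal.span (genSet (f + 10))) b := fun a b h =>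
    Ideal.Quotient.eq.2 (Ideal.subset_span h)
  constructor <;> simp only [← map_mul, ← map_pow]
  · intro i j hi hij hj
    refine key _ _ (.inl (.inl (.inl (.inl (.inl (.inl ?_))))))
    exact ⟨i, j, by omega, by omega, hij, rfl⟩
  · intro i hi hi'
    refine key _ _ (.inl (.inl (.inl (.inl (.inl (.inl ?_))))))
    exact ⟨i, f + 8, by omega, by omega, by omega, rfl⟩
  · intro i hi hi'
    refine key _ _ (.inl (.inl (.inl (.inl (.inl (.inr ?_))))))
    exact ⟨i, by omega, rfl⟩
  · refine key _ _ (.inl (.inl (.inl (.inl (.inl (.inr ?_))))))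
    exact ⟨f + 8, by omega, rfl⟩
  · intro i hi hi'
    exact key _ _ (.inl (.inl (.inl (.inl (.inr ⟨i, by omega, rfl⟩)))))
  · exact key _ _ (.inl (.inl (.inl (.inl (.inr ⟨f + 6, by omega, rfl⟩)))))
  · exact key _ _ (.inl (.inl (.inl (.inr rfl))))
  · intro j hj hj'
    refine key _ _ (.inl (.inl (.inr ⟨f + 4 - j, by omega, ?_⟩)))
    have h1 : f + 10 - 4 - (f + 4 - j) = j + 2 := by omega
    have h2 : f + 10 - 6 - (f + 4 - j) = j := by omega
    rw [h1, h2]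
    rfl
  · exact key _ _ (.inl (.inr rfl))
  · exact key _ _ (.inr (.inl rfl))
  · exact key _ _ (.inr (.inr rfl))

theorem SallyRelations.isNormalForm_pow_mul {A : Type*} [CommRing A] {f : ℕ} {y : ℕ → A}
    (H : SallyRelations f y) {i s : ℕ} {a : A} (hi : i < f + 10 ∧ i ≠ 1 ∧ i ≠ f + 7)
    (ha : IsNormalForm f y s a) (k : ℕ) :
    IsNormalForm f y (k * (f + 10 + i) + s) (y i ^ k * a) := by
  induction k with
  | zero => exact ha.congr (by ring) (by ring)
  | succ k ih => exact (H.isNormalForm_var_mul hi ih).congr (by ring) (by ring)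

theorem isNormalForm_mk_monomial (f : ℕ) (u : SallyIdx (f + 10) 1 (f + 10 - 3) →₀ ℕ) :
    IsNormalForm f (fun i => Ideal.Quotient.mk (Ideal.span (genSet (f + 10)))
      (sX (f + 10) 1 (f + 10 - 3) i)) (Finsupp.weight (fun i => f + 10 + i.1) u)
      (Ideal.Quotient.mk (Ideal.span (genSet (f + 10))) (monomial u 1)) := by
  induction u using Finsupp.induction with
  | zero => exact isNormalForm_one.congr (by simp) (by simp)
  | single_add i k u _ _ ih =>
    refine ((sallyRelations_mk f).isNormalForm_pow_mul i.2 ih k).congr ?_ ?_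
    · simp [Finsupp.weight_single]
    · rw [sX_of_valid i.2, ← map_pow, ← map_mul, monomial_single_add]

theorem aeval_monomial_eq_X_pow {e m n : ℕ} (u : SallyIdx e m n →₀ ℕ) :
    aeval (fun i : SallyIdx e m n => (Polynomial.X : Polynomial ℚ) ^ (e + i.1))
      (monomial u (1 : ℚ)) = Polynomial.X ^ Finsupp.weight (fun i => e + i.1) u := by
  rw [aeval_monomial, map_one, one_mul, Finsupp.weight_apply, Finsupp.prod, Finsupp.sum,
    ← Finset.prod_pow_eq_pow_sum]
  refine Finset.prod_congr rfl fun i _ => ?_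
  rw [← pow_mul, smul_eq_mul, mul_comm]

/-- An ideal contains the toric ideal as soon as monomials of equal weight are congruent. -/
theorem sallyIdeal_le_of_monomial_congr {e m n : ℕ}
    {I : Ideal (MvPolynomial (SallyIdx e m n) ℚ)}
    (h : ∀ u v : SallyIdx e m n →₀ ℕ, Finsupp.weight (fun i => e + i.1) u =
      Finsupp.weight (fun i => e + i.1) v →
        Ideal.Quotient.mk I (monomial u 1) = Ideal.Quotient.mk I (monomial v 1)) :
    sallyIdeal e m n ≤ I := by
  classical
  let w : (SallyIdx e m n →₀ ℕ) → ℕ := Finsupp.weight (fun i => e + i.1)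
  let Φ : Polynomial ℚ →ₗ[ℚ] (MvPolynomial (SallyIdx e m n) ℚ ⧸ I) :=
    (Polynomial.basisMonomials ℚ).constr ℚ fun s =>
      Ideal.Quotient.mk I (monomial (Function.invFun w s) 1)
  have hΦ : Φ ∘ₗ (aeval (fun i : SallyIdx e m n =>
      (Polynomial.X : Polynomial ℚ) ^ (e + i.1))).toLinearMap =
      (Ideal.Quotient.mkₐ ℚ I).toLinearMap := by
    refine (basisMonomials (SallyIdx e m n) ℚ).ext fun u => ?_
    have h1 : Φ (Polynomial.X ^ w u) =
        Ideal.Quotient.mk I (monomial (Function.invFun w (w u)) 1) := by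
      rw [← Polynomial.monomial_one_right_eq_X_pow]
      exact (Polynomial.basisMonomials ℚ).constr_basis ℚ _ (w u)
    rw [coe_basisMonomials, LinearMap.comp_apply, AlgHom.toLinearMap_apply,
      aeval_monomial_eq_X_pow, AlgHom.toLinearMap_apply, Ideal.Quotient.mkₐ_eq_mk]
    exact h1.trans (h _ _ (Function.invFun_eq ⟨u, rfl⟩))
  intro p hp
  rw [mem_sallyIdeal] at hp
  have := LinearMap.congr_fun hΦ p
  rw [LinearMap.comp_apply, AlgHom.toLinearMap_apply, hp, map_zero] at this
  exact Ideal.Quotient.eq_zero_iff_mem.1 this.symm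

theorem span_genSet (f : ℕ) :
    Ideal.span (genSet (f + 10)) = sallyIdeal (f + 10) 1 (f + 10 - 3) := by
  refine le_antisymm (Ideal.span_le.2 (genSet_subset_sallyIdeal f))
    (sallyIdeal_le_of_monomial_congr fun u v huv => ?_)
  have hu := isNormalForm_mk_monomial f u
  rw [huv] at hu
  exact hu.unique (isNormalForm_mk_monomial f v)

/-! ### Minimality -/

/-- The sum of the coefficients of the quadratic monomials `x_a x_b` with `a + b = s` and
`p ≤ a, b`. -/
noncomputable def quadricSum (e m n p s : ℕ) : MvPolynomial (SallyIdx e m n) ℚ →ₗ[ℚ] ℚ :=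
  open Classical in
  (basisMonomials (SallyIdx e m n) ℚ).constr ℚ fun u =>
    if u.degree = 2 ∧ Finsupp.weight (fun i : SallyIdx e m n => i.1) u = s ∧
      ∀ i, u i ≠ 0 → p ≤ i.1 then 1 else 0

section Minimality

variable {e m n p s : ℕ}

open Classical in
theorem quadricSum_monomial (u : SallyIdx e m n →₀ ℕ) :
    quadricSum e m n p s (monomial u 1) =
      if u.degree = 2 ∧ Finsupp.weight (fun i : SallyIdx e m n => i.1) u = s ∧
        ∀ i, u i ≠ 0 → p ≤ i.1 then 1 else 0 := by
  have := (basisMonomials (SallyIdx e m n) ℚ).constr_basis ℚ (fun u =>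
    if u.degree = 2 ∧ Finsupp.weight (fun i : SallyIdx e m n => i.1) u = s ∧
      ∀ i, u i ≠ 0 → p ≤ i.1 then (1 : ℚ) else 0) u
  rwa [coe_basisMonomials] at this

theorem sX_mul_sX {a b : ℕ} (ha : a < e ∧ a ≠ m ∧ a ≠ n) (hb : b < e ∧ b ≠ m ∧ b ≠ n) :
    sX e m n a * sX e m n b =
      monomial (Finsupp.single ⟨a, ha⟩ 1 + Finsupp.single ⟨b, hb⟩ 1) 1 := by
  rw [sX_of_valid ha, sX_of_valid hb, X, X, monomial_mul, one_mul]

theorem quadricSum_mul {a b : ℕ} (ha : a < e ∧ a ≠ m ∧ a ≠ n) (hb : b < e ∧ b ≠ m ∧ b ≠ n) :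
    quadricSum e m n p s (sX e m n a * sX e m n b) =
      if a + b = s ∧ p ≤ a ∧ p ≤ b then 1 else 0 := by
  classical
  rw [sX_mul_sX ha hb, quadricSum_monomial]
  refine if_congr ?_ rfl rfl
  simp only [map_add, Finsupp.degree_single, Finsupp.weight_single, one_smul, true_and,
    Nat.reduceAdd]
  refine and_congr_right fun _ => ⟨fun h => ⟨h ⟨a, ha⟩ ?_, h ⟨b, hb⟩ ?_⟩, ?_⟩
  · simp
  · simp
  · rintro ⟨h1, h2⟩ i hi
    by_cases hia : i = ⟨a, ha⟩
    · subst hia; exact h1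
    by_cases hib : i = ⟨b, hb⟩
    · subst hib; exact h2
    · exact absurd (by simp [Ne.symm hia, Ne.symm hib]) hi

theorem quadricSum_monomial_eq_zero {u : SallyIdx e m n →₀ ℕ} (hu : 3 ≤ u.degree) :
    quadricSum e m n p s (monomial u 1) = 0 := by
  classical
  rw [quadricSum_monomial, if_neg]
  rintro ⟨h, -⟩
  omega

theorem quadricSum_monomial_mul_mul {u : SallyIdx e m n →₀ ℕ} (hu : u ≠ 0) {a b : ℕ}
    (ha : a < e ∧ a ≠ m ∧ a ≠ n) (hb : b < e ∧ b ≠ m ∧ b ≠ n) :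
    quadricSum e m n p s (monomial u 1 * (sX e m n a * sX e m n b)) = 0 := by
  have h0 : u.degree ≠ 0 := fun h => hu ((Finsupp.degree_eq_zero_iff u).1 h)
  rw [sX_mul_sX ha hb, monomial_mul, one_mul]
  refine quadricSum_monomial_eq_zero ?_
  simp only [map_add, Finsupp.degree_single]
  omega

theorem quadricSum_monomial_mul_cubic (u : SallyIdx e m n →₀ ℕ) {a b c : ℕ}
    (ha : a < e ∧ a ≠ m ∧ a ≠ n) (hb : b < e ∧ b ≠ m ∧ b ≠ n) (hc : c < e ∧ c ≠ m ∧ c ≠ n) :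
    quadricSum e m n p s (monomial u 1 * (sX e m n a * sX e m n b * sX e m n c)) = 0 := by
  rw [sX_mul_sX ha hb, sX_of_valid hc, X, monomial_mul, monomial_mul, one_mul, one_mul]
  refine quadricSum_monomial_eq_zero ?_
  simp only [map_add, Finsupp.degree_single]
  omega

theorem map_eq_zero_of_mem_span {σ R : Type*} [CommSemiring R]
    (φ : MvPolynomial σ R →ₗ[R] R) {T : Set (MvPolynomial σ R)}
    (h : ∀ t ∈ T, ∀ u, φ (monomial u 1 * t) = 0) {g : MvPolynomial σ R}
    (hg : g ∈ Ideal.span T) : φ g = 0 := by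
  suffices H : ∀ p, φ (p * g) = 0 by simpa using H 1
  induction hg using Submodule.span_induction with
  | mem t ht =>
    have h0 : φ ∘ₗ LinearMap.mulRight R t = 0 :=
      (basisMonomials σ R).ext fun u => by simpa using h t ht u
    exact fun p => LinearMap.congr_fun h0 p
  | zero => simp
  | add x y _ _ hx hy => intro p; rw [mul_add, map_add, hx, hy, add_zero]
  | smul a x _ hx => intro p; rw [smul_eq_mul, ← mul_assoc, hx]

end Minimality

/-- The monomial of `G` paired with `x_p x_q`, for `p ≤ q`. -/
noncomputable def partner (f p q : ℕ) : MvPolynomial (SallyIdx (f + 10) 1 (f + 10 - 3)) ℚ :=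
  let x := sX (f + 10) 1 (f + 10 - 3)
  if p = 2 then if q = f + 8 then x 0 * x 0 * x 0 else x 0 * x (q + 2)
  else if q = f + 9 then if p = f + 8 then x 0 * x 2 * x (f + 5) else x 0 * x 0 * x (p - 1)
  else if q = f + 8 then if p = f + 8 then x 0 * x 0 * x (f + 6) else x (p - 1) * x (f + 9)
  else if q = f + 6 then if p = 3 then x 0 * x (f + 9) else x (p - 2) * x (f + 8)
  else x (p - 1) * x (q + 1)

/-- The pairs `(p, q)` such that `x_p x_q` is paired with `partner f p q` in `G`. -/
def IsPaired (f p q : ℕ) : Prop :=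
  2 ≤ p ∧ p ≤ q ∧ q ≤ f + 9 ∧ p ≠ f + 7 ∧ q ≠ f + 7 ∧
    ¬ (p = 2 ∧ q = f + 9) ∧ ¬ (p = 2 ∧ q = f + 5)

/-- The element of `G` involving `x_p x_q` and its partner. -/
noncomputable def pairBinomial (f p q : ℕ) :
    MvPolynomial (SallyIdx (f + 10) 1 (f + 10 - 3)) ℚ :=
  let x := sX (f + 10) 1 (f + 10 - 3)
  if q = f + 6 ∧ p ≠ 2 then x p * x q - partner f p q else partner f p q - x p * x q

theorem exists_pairBinomial_of_mem_genSet {f : ℕ}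
    {g : MvPolynomial (SallyIdx (f + 10) 1 (f + 10 - 3)) ℚ} (hg : g ∈ genSet (f + 10)) :
    ∃ p q, IsPaired f p q ∧ g = pairBinomial f p q := by
  have e1 : f + 10 - 1 = f + 9 := rfl
  have e2 : f + 10 - 2 = f + 8 := rfl
  have e4 : f + 10 - 4 = f + 6 := rfl
  rcases hg with (((((⟨i, j, hi, hj, hij, rfl⟩ | ⟨i, hi, rfl⟩) | ⟨i, hi, rfl⟩) | rfl) |
    ⟨i, hi, rfl⟩) | rfl) | rfl | rfl
  · refine ⟨i + 1, j, by unfold IsPaired; omega, ?_⟩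
    have h1 : ¬ (j = f + 6 ∧ i + 1 ≠ 2) := by omega
    have h2 : i + 1 ≠ 2 := by omega
    have h3 : j ≠ f + 9 := by omega
    have h4 : j ≠ f + 6 := by omega
    have h5 : i + 1 ≠ f + 8 := by omega
    rw [pairBinomial, if_neg h1, partner]
    by_cases h6 : j = f + 8
    · rw [if_neg h2, if_neg h3, if_pos h6, if_neg h5, h6]
      rfl
    · rw [if_neg h2, if_neg h3, if_neg h6, if_neg h4]
      rfl
  · refine ⟨i + 1, f + 9, by unfold IsPaired; omega, ?_⟩
    have h1 : ¬ (f + 9 = f + 6 ∧ i + 1 ≠ 2) := by omega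
    have h2 : i + 1 ≠ 2 := by omega
    have h3 : i + 1 ≠ f + 8 := by omega
    rw [pairBinomial, if_neg h1, partner, if_neg h2, if_pos rfl, if_neg h3, e1, sq]
    rfl
  · refine ⟨2, i, by unfold IsPaired; omega, ?_⟩
    have h : i ≠ f + 8 := by omega
    simp [pairBinomial, partner, h]
  · refine ⟨2, f + 8, by unfold IsPaired; omega, ?_⟩
    simp [pairBinomial, partner]
    ring
  · refine ⟨f + 6 - i, f + 6, by unfold IsPaired; omega, ?_⟩
    have h2 : f + 6 - i ≠ 2 := by omega
    have h3 : f + 6 - i ≠ 3 := by omega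
    have h7 : f + 10 - 4 - i = f + 6 - i := by omega
    have h8 : f + 6 - i - 2 = f + 10 - 6 - i := by omega
    have h1 : f + 6 = f + 6 ∧ f + 6 - i ≠ 2 := ⟨rfl, h2⟩
    have h4 : f + 6 ≠ f + 9 := by omega
    have h5 : f + 6 ≠ f + 8 := by omega
    rw [pairBinomial, if_pos h1, partner, if_neg h2, if_neg h4, if_neg h5, if_pos rfl,
      if_neg h3, h7, h8, e4, e2]
    ring
  · refine ⟨3, f + 6, by unfold IsPaired; omega, ?_⟩
    simp [pairBinomial, partner]
    ring
  · refine ⟨f + 8, f + 8, by unfold IsPaired; omega, ?_⟩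
    simp [pairBinomial, partner]
    ring
  · refine ⟨f + 8, f + 9, by unfold IsPaired; omega, ?_⟩
    simp [pairBinomial, partner]

theorem partner_cases {f p q : ℕ} (h : IsPaired f p q) :
    (∃ a b, (a < f + 10 ∧ a ≠ 1 ∧ a ≠ f + 10 - 3) ∧ (b < f + 10 ∧ b ≠ 1 ∧ b ≠ f + 10 - 3) ∧
      (∀ k l, IsPaired f k l → (a + b = k + l ∧ k ≤ a ∧ k ≤ b ↔ p + q = k + l ∧ k < p)) ∧
      partner f p q = sX (f + 10) 1 (f + 10 - 3) a * sX (f + 10) 1 (f + 10 - 3) b) ∨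
    (∃ a b c, (a < f + 10 ∧ a ≠ 1 ∧ a ≠ f + 10 - 3) ∧
      (b < f + 10 ∧ b ≠ 1 ∧ b ≠ f + 10 - 3) ∧ (c < f + 10 ∧ c ≠ 1 ∧ c ≠ f + 10 - 3) ∧
      (∀ k l, IsPaired f k l → ¬ (p + q = k + l ∧ k < p)) ∧
      partner f p q = sX (f + 10) 1 (f + 10 - 3) a * sX (f + 10) 1 (f + 10 - 3) b *
        sX (f + 10) 1 (f + 10 - 3) c) := by
  unfold IsPaired at *
  generalize hP : partner f p q = P
  simp only [partner] at hP
  split_ifs at hP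
  · exact .inr ⟨_, _, _, by omega, by omega, by omega, by omega, hP.symm⟩
  · exact .inl ⟨_, _, by omega, by omega, by omega, hP.symm⟩
  · exact .inr ⟨_, _, _, by omega, by omega, by omega, by omega, hP.symm⟩
  · exact .inr ⟨_, _, _, by omega, by omega, by omega, by omega, hP.symm⟩
  · exact .inr ⟨_, _, _, by omega, by omega, by omega, by omega, hP.symm⟩
  · exact .inl ⟨_, _, by omega, by omega, by omega, hP.symm⟩
  · exact .inl ⟨_, _, by omega, by omega, by omega, hP.symm⟩
  · exact .inl ⟨_, _, by omega, by omega, by omega, hP.symm⟩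
  · exact .inl ⟨_, _, by omega, by omega, by omega, hP.symm⟩

theorem IsPaired.valid_left {f p q : ℕ} (h : IsPaired f p q) :
    p < f + 10 ∧ p ≠ 1 ∧ p ≠ f + 10 - 3 := by
  unfold IsPaired at h; omega

theorem IsPaired.valid_right {f p q : ℕ} (h : IsPaired f p q) :
    q < f + 10 ∧ q ≠ 1 ∧ q ≠ f + 10 - 3 := by
  unfold IsPaired at h; omega

theorem quadricSum_monomial_mul_partner {f p q k s : ℕ} (h : IsPaired f p q)
    {u : SallyIdx (f + 10) 1 (f + 10 - 3) →₀ ℕ} (hu : u ≠ 0) :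
    quadricSum (f + 10) 1 (f + 10 - 3) k s (monomial u 1 * partner f p q) = 0 := by
  obtain ⟨a, b, ha, hb, -, hP⟩ | ⟨a, b, c, ha, hb, hc, -, hP⟩ := partner_cases h
  · rw [hP, quadricSum_monomial_mul_mul hu ha hb]
  · rw [hP, quadricSum_monomial_mul_cubic u ha hb hc]

theorem quadricSum_partner {f p q k l : ℕ} (h : IsPaired f p q) (h' : IsPaired f k l) :
    quadricSum (f + 10) 1 (f + 10 - 3) k (k + l) (partner f p q) =
      if p + q = k + l ∧ k < p then 1 else 0 := by
  obtain ⟨a, b, ha, hb, hi, hP⟩ | ⟨a, b, c, ha, hb, hc, hi, hP⟩ := partner_cases h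
  · rw [hP, quadricSum_mul ha hb]
    exact if_congr (hi k l h') rfl rfl
  · rw [hP, if_neg (hi k l h')]
    have := quadricSum_monomial_mul_cubic (p := k) (s := k + l) 0 ha hb hc
    rwa [monomial_zero', C_1, one_mul] at this

theorem quadricSum_mul_sub_partner {f p q k l : ℕ} (h : IsPaired f p q) (h' : IsPaired f k l) :
    quadricSum (f + 10) 1 (f + 10 - 3) k (k + l) (sX (f + 10) 1 (f + 10 - 3) p *
      sX (f + 10) 1 (f + 10 - 3) q - partner f p q) = if p = k ∧ q = l then 1 else 0 := by
  rw [map_sub, quadricSum_mul h.valid_left h.valid_right, quadricSum_partner h h']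
  unfold IsPaired at h h'
  split_ifs <;> first | omega | norm_num

theorem pairBinomial_eq_or (f p q : ℕ) :
    pairBinomial f p q = sX (f + 10) 1 (f + 10 - 3) p * sX (f + 10) 1 (f + 10 - 3) q -
        partner f p q ∨
    pairBinomial f p q = -(sX (f + 10) 1 (f + 10 - 3) p * sX (f + 10) 1 (f + 10 - 3) q -
        partner f p q) := by
  rw [neg_sub]
  exact ite_eq_or_eq _ _ _

theorem quadricSum_monomial_mul_pairBinomial {f p q k l : ℕ} (h : IsPaired f p q)
    (h' : IsPaired f k l) (hne : ¬ (p = k ∧ q = l))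
    (u : SallyIdx (f + 10) 1 (f + 10 - 3) →₀ ℕ) :
    quadricSum (f + 10) 1 (f + 10 - 3) k (k + l) (monomial u 1 * pairBinomial f p q) = 0 := by
  suffices H : quadricSum (f + 10) 1 (f + 10 - 3) k (k + l) (monomial u 1 *
      (sX (f + 10) 1 (f + 10 - 3) p * sX (f + 10) 1 (f + 10 - 3) q - partner f p q)) = 0 by
    rcases pairBinomial_eq_or f p q with hb | hb
    · rw [hb, H]
    · rw [hb, mul_neg, map_neg, H, neg_zero]
  rcases eq_or_ne u 0 with rfl | hu
  · rw [monomial_zero', C_1, one_mul, quadricSum_mul_sub_partner h h', if_neg hne]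
  · rw [mul_sub, map_sub, quadricSum_monomial_mul_mul hu h.valid_left h.valid_right,
      quadricSum_monomial_mul_partner h hu, sub_zero]

theorem quadricSum_pairBinomial_ne_zero {f p q : ℕ} (h : IsPaired f p q) :
    quadricSum (f + 10) 1 (f + 10 - 3) p (p + q) (pairBinomial f p q) ≠ 0 := by
  rcases pairBinomial_eq_or f p q with hb | hb
  · rw [hb, quadricSum_mul_sub_partner h h, if_pos ⟨rfl, rfl⟩]
    exact one_ne_zero
  · rw [hb, map_neg, quadricSum_mul_sub_partner h h, if_pos ⟨rfl, rfl⟩]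
    exact neg_ne_zero.2 one_ne_zero

theorem notMem_span_genSet_diff {f : ℕ} {g : MvPolynomial (SallyIdx (f + 10) 1 (f + 10 - 3)) ℚ}
    (hg : g ∈ genSet (f + 10)) : g ∉ Ideal.span (genSet (f + 10) \ {g}) := by
  obtain ⟨p, q, h, rfl⟩ := exists_pairBinomial_of_mem_genSet hg
  refine fun hmem => quadricSum_pairBinomial_ne_zero h (map_eq_zero_of_mem_span _ ?_ hmem)
  rintro t ⟨ht, hne⟩ u
  obtain ⟨p', q', h', rfl⟩ := exists_pairBinomial_of_mem_genSet ht
  refine quadricSum_monomial_mul_pairBinomial h' h ?_ u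
  rintro ⟨rfl, rfl⟩
  exact hne rfl

theorem stmt4 (e : ℕ) (he : 10 ≤ e) :
    Ideal.span (genSet e) = sallyIdeal e 1 (e-3) ∧
    ∀ G' : Set (MvPolynomial (SallyIdx e 1 (e-3)) ℚ), G' ⊂ genSet e →
      Ideal.span G' ≠ sallyIdeal e 1 (e-3) := by
  obtain ⟨f, rfl⟩ := Nat.exists_eq_add_of_le' he
  refine ⟨span_genSet f, fun G' hG' hspan => ?_⟩
  obtain ⟨g, hg, hgG'⟩ := Set.exists_of_ssubset hG'
  refine notMem_span_genSet_diff hg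
    (Ideal.span_mono (Set.subset_sdiff_singleton hG'.subset hgG') ?_)
  rw [hspan]
  exact genSet_subset_sallyIdeal f hg
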